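/- arXiv:1910.01359 — 3 statements merged into one kernel-verified Lean document; each statement's English description precedes it below -/
import Mathlib

section
/- Let Y be a topological space, y₀ ∈ Y, and let m ≥ 1 and k ≥ 2 be natural numbers. Then there is a group isomorphism π_k(C(S^m, Y), c_{y₀}) ≅ π_k(Y, y₀) × π_{m+k}(Y, y₀), where c_{y₀} ∈ C(S^m, Y) denotes the constant map with value y₀. -/
open Topology

/-- The unit sphere `S^m ⊆ ℝ^{m+1}` centered at the origin. -/
noncomputable def Sph (m : ℕ) : Set (EuclideanSpace ℝ (Fin (m + 1))) :=
  Metric.sphere (0 : EuclideanSpace ℝ (Fin (m + 1))) 1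

/-- The north pole `N = (0, …, 0, 1) ∈ S^m`. -/
noncomputable def northPole (m : ℕ) : Sph m :=
  ⟨EuclideanSpace.single (Fin.last m) (1 : ℝ), by
    simp [Sph, EuclideanSpace.norm_single]⟩

open scoped unitInterval Topology.Homotopy

namespace GenLoop

variable {N X : Type*} [TopologicalSpace X] {x : X}

theorem homotopic_of_continuousMap {f g : Ω^ N X x} (H : C(I × (I^N), X))
    (h₀ : ∀ y, H (0, y) = f y) (h₁ : ∀ y, H (1, y) = g y)
    (hb : ∀ t, ∀ y ∈ Cube.boundary N, H (t, y) = x) : Homotopic f g :=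
  ⟨⟨⟨H, h₀, h₁⟩, fun t y hy ↦ (hb t y hy).trans (f.2 y hy).symm⟩⟩

theorem Homotopic.exists_continuousMap {f g : Ω^ N X x} (h : Homotopic f g) :
    ∃ H : C(I × (I^N), X), (∀ y, H (0, y) = f y) ∧ (∀ y, H (1, y) = g y) ∧
      ∀ t, ∀ y ∈ Cube.boundary N, H (t, y) = x := by
  obtain ⟨H⟩ := h
  exact ⟨H.toContinuousMap, H.apply_zero, H.apply_one,
    fun t y hy ↦ (H.eq_fst t hy).trans (f.2 y hy)⟩

end GenLoop

namespace HomotopyGroup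

open GenLoop

variable {N N' X X' : Type*} [TopologicalSpace X] [TopologicalSpace X'] {x : X} {x' : X'}
  [DecidableEq N] [DecidableEq N'] [Nonempty N] [Nonempty N']

/-- The homomorphism of homotopy groups induced by a map of generalized loops which preserves
homotopies and concatenation along some coordinate. -/
noncomputable def homOfGenLoop (Φ : Ω^ N X x → Ω^ N' X' x')
    (hΦ : ∀ f g, Homotopic f g → Homotopic (Φ f) (Φ g)) (i : N) (i' : N')
    (hmul : ∀ f g, Φ (transAt i f g) = transAt i' (Φ f) (Φ g)) :
    HomotopyGroup N X x →* HomotopyGroup N' X' x' :=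
  MonoidHom.mk' (Quotient.map Φ hΦ) fun a b ↦ Quotient.inductionOn₂ a b fun p q ↦ by
    have h₁ := mul_spec (i := i) (p := p) (q := q)
    have h₂ := mul_spec (i := i') (p := Φ p) (q := Φ q)
    dsimp only at h₁ h₂
    rw [h₁]
    refine Eq.trans ?_ h₂.symm
    rw [← hmul]
    rfl

end HomotopyGroup

namespace GenLoop

variable {N X X' : Type*} [TopologicalSpace X] [TopologicalSpace X'] {x : X} {x' : X'}

/-- Postcomposition of a generalized loop with a continuous map. -/
def map (φ : C(X, X')) (hφ : φ x = x') (f : Ω^ N X x) : Ω^ N X' x' :=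
  ⟨φ.comp f.1, fun y hy ↦ (congrArg φ (f.2 y hy)).trans hφ⟩

theorem map_apply (φ : C(X, X')) (hφ : φ x = x') (f : Ω^ N X x) (y : I^N) :
    map φ hφ f y = φ (f y) := rfl

theorem Homotopic.map (φ : C(X, X')) (hφ : φ x = x') {f g : Ω^ N X x} (h : Homotopic f g) :
    Homotopic (GenLoop.map φ hφ f) (GenLoop.map φ hφ g) := by
  obtain ⟨H, h₀, h₁, hb⟩ := h.exists_continuousMap
  exact homotopic_of_continuousMap (φ.comp H) (fun y ↦ congrArg φ (h₀ y))
    (fun y ↦ congrArg φ (h₁ y)) fun t y hy ↦ (congrArg φ (hb t y hy)).trans hφ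

theorem transAt_apply [DecidableEq N] (i : N) (f g : Ω^ N X x) (t : I^N) :
    transAt i f g t = if (t i : ℝ) ≤ 1 / 2
      then f (Function.update t i <| Set.projIcc 0 1 zero_le_one (2 * t i))
      else g (Function.update t i <| Set.projIcc 0 1 zero_le_one (2 * t i - 1)) := rfl

theorem map_transAt [DecidableEq N] (φ : C(X, X')) (hφ : φ x = x') (i : N) (f g : Ω^ N X x) :
    map φ hφ (transAt i f g) = transAt i (map φ hφ f) (map φ hφ g) := by
  ext t
  simp only [map_apply, transAt_apply]
  split_ifs <;> rfl

end GenLoop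

/-- The homomorphism of homotopy groups induced by a continuous map. -/
noncomputable def HomotopyGroup.map {N X X' : Type*} [TopologicalSpace X] [TopologicalSpace X']
    {x : X} {x' : X'} [DecidableEq N] [Nonempty N] (φ : C(X, X')) (hφ : φ x = x') :
    HomotopyGroup N X x →* HomotopyGroup N X' x' :=
  homOfGenLoop (GenLoop.map φ hφ) (fun _ _ h ↦ h.map φ hφ) (Classical.arbitrary N)
    (Classical.arbitrary N) fun f g ↦ GenLoop.map_transAt φ hφ _ f g

namespace Cube

/-- Scaling of the cube by the factor `c` about its centre, clamped to the cube. -/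
noncomputable def scale {M : Type*} (c : ℝ) (s : I^M) : I^M :=
  fun i ↦ Set.projIcc 0 1 zero_le_one (c * ((s i : ℝ) - 1 / 2) + 1 / 2)

@[fun_prop]
theorem continuous_scale {M Z : Type*} [TopologicalSpace Z] {c : Z → ℝ} {s : Z → I^M}
    (hc : Continuous c) (hs : Continuous s) : Continuous fun z ↦ scale (c z) (s z) := by
  unfold scale
  refine continuous_pi fun i ↦ continuous_projIcc.comp ?_
  fun_prop

theorem scale_one {M : Type*} (s : I^M) : scale 1 s = s := by
  ext i
  have : (1 : ℝ) * ((s i : ℝ) - 1 / 2) + 1 / 2 = s i := by ring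
  rw [scale, this, Set.projIcc_val]

variable {M : Type*} [Fintype M]

/-- The distance to the centre of the cube, normalized to equal `1` on the boundary. -/
noncomputable def radius (s : I^M) : ℝ := ‖fun i ↦ 2 * (s i : ℝ) - 1‖

@[fun_prop]
theorem continuous_radius : Continuous (radius (M := M)) := by
  unfold radius; fun_prop

theorem radius_le_one (s : I^M) : radius s ≤ 1 := by
  refine (pi_norm_le_iff_of_nonneg zero_le_one).2 fun i ↦ ?_
  rw [Real.norm_eq_abs, abs_le]
  constructor <;> linarith [(s i).2.1, (s i).2.2]

theorem exists_abs_eq_radius [Nonempty M] (s : I^M) : ∃ i, |2 * (s i : ℝ) - 1| = radius s := by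
  obtain ⟨i, hi⟩ := Finite.exists_max fun i ↦ |2 * (s i : ℝ) - 1|
  refine ⟨i, le_antisymm (norm_le_pi_norm (fun i ↦ 2 * (s i : ℝ) - 1) i) ?_⟩
  exact (pi_norm_le_iff_of_nonneg (abs_nonneg _)).2 hi

theorem radius_eq_one_of_mem_boundary {s : I^M} (hs : s ∈ boundary M) : radius s = 1 := by
  refine le_antisymm (radius_le_one s) ?_
  obtain ⟨i, hi⟩ := hs
  refine le_trans ?_ (norm_le_pi_norm (fun i ↦ 2 * (s i : ℝ) - 1) i)
  rcases hi with hi | hi <;> norm_num [hi]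

theorem scale_mem_boundary [Nonempty M] {c : ℝ} {s : I^M} (h : 1 ≤ c * radius s) :
    scale c s ∈ boundary M := by
  obtain ⟨i, hi⟩ := exists_abs_eq_radius s
  refine ⟨i, ?_⟩
  rw [← hi] at h
  rcases abs_cases (2 * (s i : ℝ) - 1) with ⟨h₁, -⟩ | ⟨h₁, -⟩ <;> rw [h₁] at h
  · exact Or.inr (Set.projIcc_of_right_le _ (by linarith))
  · exact Or.inl (Set.projIcc_of_le_left _ (by linarith))

theorem mem_boundary_of_radius_eq_one [Nonempty M] {s : I^M} (hs : radius s = 1) :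
    s ∈ boundary M := by
  rw [← scale_one s]
  exact scale_mem_boundary (by rw [hs, one_mul])

end Cube

/-- Evaluation at a point, as a continuous map. -/
def ContinuousMap.evalAt {K : Type*} [TopologicalSpace K] (Y : Type*) [TopologicalSpace Y] (p : K) :
    C(C(K, Y), Y) :=
  ⟨fun φ ↦ φ p, continuous_eval_const p⟩

/-- A presentation of the pointed space `(K, p)` as the quotient of a cube by its boundary. -/
structure IsCubeModBoundary {M K : Type*} [TopologicalSpace K] (q : C(I^M, K)) (p : K) : Prop where
  surjective : Function.Surjective q
  apply_of_mem : ∀ s ∈ Cube.boundary M, q s = p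
  eq_or_mem : ∀ s s', q s = q s' → s = s' ∨ s ∈ Cube.boundary M ∧ s' ∈ Cube.boundary M

namespace IsCubeModBoundary

variable {M K : Type*} [TopologicalSpace K] {q : C(I^M, K)} {p : K} {Y : Type*}
  [TopologicalSpace Y]

theorem exists_lift [T2Space K] (hq : IsCubeModBoundary q p) {Z : Type*} [TopologicalSpace Z]
    [CompactSpace Z] [T2Space Z] (G : C(Z × (I^M), Y))
    (hG : ∀ z, ∀ s ∈ Cube.boundary M, ∀ s' ∈ Cube.boundary M, G (z, s) = G (z, s')) :
    ∃ F : C(Z, C(K, Y)), ∀ z s, F z (q s) = G (z, s) := by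
  let Q : C(Z × (I^M), Z × K) := (ContinuousMap.id Z).prodMap q
  have hQ : IsQuotientMap Q := IsQuotientMap.of_surjective_continuous
    (Function.surjective_id.prodMap hq.surjective) Q.continuous
  refine ⟨(hQ.lift G ?_).curry, fun z s ↦ ?_⟩
  · rintro ⟨z, s⟩ ⟨z', s'⟩ h
    obtain ⟨rfl, hqs⟩ : z = z' ∧ q s = q s' := Prod.ext_iff.1 h
    rcases hq.eq_or_mem s s' hqs with rfl | ⟨hs, hs'⟩
    exacts [rfl, hG z s hs s' hs']
  · exact DFunLike.congr_fun (hQ.lift_comp G _) (z, s)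

variable {N : Type*} {y : Y}

theorem exists_genLoop [T2Space K] (hq : IsCubeModBoundary q p) (G : C((I^N) × (I^M), Y))
    (hG : ∀ t, ∀ s ∈ Cube.boundary M, ∀ s' ∈ Cube.boundary M, G (t, s) = G (t, s'))
    (hb : ∀ t ∈ Cube.boundary N, ∀ s, G (t, s) = y) :
    ∃ f : Ω^ N C(K, Y) (ContinuousMap.const K y), ∀ t s, f t (q s) = G (t, s) := by
  obtain ⟨F, hF⟩ := hq.exists_lift G hG
  refine ⟨⟨F, fun t ht ↦ ?_⟩, hF⟩
  ext z
  obtain ⟨s, rfl⟩ := hq.surjective z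
  exact (hF t s).trans (hb t ht s)

theorem homotopic_of_continuousMap [T2Space K] (hq : IsCubeModBoundary q p)
    {f g : Ω^ N C(K, Y) (ContinuousMap.const K y)} (H : C((I × (I^N)) × (I^M), Y))
    (h₀ : ∀ t s, H ((0, t), s) = f t (q s)) (h₁ : ∀ t s, H ((1, t), s) = g t (q s))
    (hH : ∀ τ t, ∀ s ∈ Cube.boundary M, ∀ s' ∈ Cube.boundary M, H ((τ, t), s) = H ((τ, t), s'))
    (hb : ∀ τ, ∀ t ∈ Cube.boundary N, ∀ s, H ((τ, t), s) = y) : GenLoop.Homotopic f g := by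
  obtain ⟨F, hF⟩ := hq.exists_lift H fun z ↦ hH z.1 z.2
  refine GenLoop.homotopic_of_continuousMap F (fun t ↦ ?_) (fun t ↦ ?_) fun τ t ht ↦ ?_
  all_goals
    ext z
    obtain ⟨s, rfl⟩ := hq.surjective z
    rw [hF]
  exacts [h₀ t s, h₁ t s, hb τ t ht s]

variable {P : Type*} (e : M ⊕ N ≃ P)

/-- The point of the cube `I^P` with coordinates `s` and `t` with respect to a partition of `P`. -/
def _root_.Cube.join (s : I^M) (t : I^N) : I^P := fun i ↦ Sum.elim s t (e.symm i)

theorem _root_.Cube.join_inl (s : I^M) (t : I^N) (i : M) : Cube.join e s t (e (.inl i)) = s i := by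
  simp [Cube.join]

theorem _root_.Cube.join_inr (s : I^M) (t : I^N) (i : N) : Cube.join e s t (e (.inr i)) = t i := by
  simp [Cube.join]

theorem _root_.Cube.join_comp (u : I^P) :
    Cube.join e (fun i ↦ u (e (.inl i))) (fun i ↦ u (e (.inr i))) = u := by
  ext i
  obtain ⟨i | i, rfl⟩ := e.surjective i <;> simp [Cube.join]

@[fun_prop]
theorem _root_.Cube.continuous_join {Z : Type*} [TopologicalSpace Z] {s : Z → I^M} {t : Z → I^N}
    (hs : Continuous s) (ht : Continuous t) : Continuous fun z ↦ Cube.join e (s z) (t z) := by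
  refine continuous_pi fun i ↦ ?_
  obtain ⟨i | i, rfl⟩ := e.surjective i
  · simp only [Cube.join_inl]; fun_prop
  · simp only [Cube.join_inr]; fun_prop

theorem _root_.Cube.join_mem_boundary_left {s : I^M} (hs : s ∈ Cube.boundary M) (t : I^N) :
    Cube.join e s t ∈ Cube.boundary P := by
  obtain ⟨i, hi⟩ := hs
  exact ⟨e (.inl i), by rwa [Cube.join_inl]⟩

theorem _root_.Cube.join_mem_boundary_right (s : I^M) {t : I^N} (ht : t ∈ Cube.boundary N) :
    Cube.join e s t ∈ Cube.boundary P := by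
  obtain ⟨i, hi⟩ := ht
  exact ⟨e (.inr i), by rwa [Cube.join_inr]⟩

theorem _root_.Cube.mem_boundary_or {u : I^P} (hu : u ∈ Cube.boundary P) :
    (fun i ↦ u (e (.inl i))) ∈ Cube.boundary M ∨ (fun i ↦ u (e (.inr i))) ∈ Cube.boundary N := by
  obtain ⟨i, hi⟩ := hu
  obtain ⟨i | i, rfl⟩ := e.surjective i
  exacts [Or.inl ⟨i, hi⟩, Or.inr ⟨i, hi⟩]

theorem _root_.Cube.join_update [DecidableEq N] [DecidableEq P] (s : I^M) (t : I^N) (i : N)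
    (a : I) : Cube.join e s (Function.update t i a) =
      Function.update (Cube.join e s t) (e (.inr i)) a := by
  ext j
  obtain ⟨j | j, rfl⟩ := e.surjective j
  · simp [Cube.join_inl]
  · simp [Cube.join_inr, Function.update_apply]

theorem exists_adjoint [T2Space K] (hq : IsCubeModBoundary q p) (g : Ω^ P Y y) :
    ∃ f : Ω^ N C(K, Y) (ContinuousMap.const K y), ∀ t s, f t (q s) = g (Cube.join e s t) :=
  hq.exists_genLoop (g.1.comp ⟨fun z ↦ Cube.join e z.2 z.1, by fun_prop⟩)
    (fun t s hs s' hs' ↦ (g.2 _ (Cube.join_mem_boundary_left e hs t)).trans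
      (g.2 _ (Cube.join_mem_boundary_left e hs' t)).symm)
    fun t ht s ↦ g.2 _ (Cube.join_mem_boundary_right e s ht)

/-- The generalized loop of maps out of the quotient `K` of a cube by its boundary that corresponds
to a generalized loop of higher dimension. -/
noncomputable def adjoint [T2Space K] (hq : IsCubeModBoundary q p) (g : Ω^ P Y y) :
    Ω^ N C(K, Y) (ContinuousMap.const K y) :=
  (hq.exists_adjoint e g).choose

theorem adjoint_apply [T2Space K] (hq : IsCubeModBoundary q p) (g : Ω^ P Y y) (t : I^N) (s : I^M) :
    hq.adjoint e g t (q s) = g (Cube.join e s t) :=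
  (hq.exists_adjoint e g).choose_spec t s

theorem homotopic_adjoint [T2Space K] (hq : IsCubeModBoundary q p) {g g' : Ω^ P Y y}
    (h : GenLoop.Homotopic g g') :
    GenLoop.Homotopic (hq.adjoint e g) (hq.adjoint e g') := by
  obtain ⟨H, h₀, h₁, hb⟩ := h.exists_continuousMap
  refine hq.homotopic_of_continuousMap
    (H.comp ⟨fun z ↦ (z.1.1, Cube.join e z.2 z.1.2), by fun_prop⟩) (fun t s ↦ ?_) (fun t s ↦ ?_)
    (fun τ t s hs s' hs' ↦ ?_) fun τ t ht s ↦ ?_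
  · exact (h₀ _).trans (hq.adjoint_apply e g t s).symm
  · exact (h₁ _).trans (hq.adjoint_apply e g' t s).symm
  · exact (hb _ _ (Cube.join_mem_boundary_left e hs t)).trans
      (hb _ _ (Cube.join_mem_boundary_left e hs' t)).symm
  · exact hb _ _ (Cube.join_mem_boundary_right e s ht)

theorem adjoint_transAt [T2Space K] (hq : IsCubeModBoundary q p) [DecidableEq N] [DecidableEq P]
    (i : N) (g g' : Ω^ P Y y) :
    hq.adjoint e (GenLoop.transAt (e (.inr i)) g g') =
      GenLoop.transAt i (hq.adjoint e g) (hq.adjoint e g') := by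
  refine GenLoop.ext _ _ fun t ↦ ContinuousMap.ext fun z ↦ ?_
  obtain ⟨s, rfl⟩ := hq.surjective z
  rw [adjoint_apply, GenLoop.transAt_apply, GenLoop.transAt_apply, Cube.join_inr]
  split_ifs <;> rw [adjoint_apply, Cube.join_update]

/-- The homomorphism `π_P(Y) → π_N(C(K, Y))` given by the exponential law, where `K` is the
quotient of the cube `I^M` by its boundary and `P` is the disjoint union of `M` and `N`. -/
noncomputable def adjointHom [T2Space K] (hq : IsCubeModBoundary q p) (y : Y) [DecidableEq N]
    [DecidableEq P] [Nonempty N] [Nonempty P] :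
    HomotopyGroup P Y y →* HomotopyGroup N C(K, Y) (ContinuousMap.const K y) :=
  HomotopyGroup.homOfGenLoop (hq.adjoint e) (fun _ _ h ↦ hq.homotopic_adjoint e h)
    (e (.inr (Classical.arbitrary N))) (Classical.arbitrary N) fun g g' ↦ hq.adjoint_transAt e _ g g'

theorem exists_homotopic_adjoint [T2Space K] [CompactSpace K] [Fintype M] [Nonempty M]
    (hq : IsCubeModBoundary q p) (f : Ω^ N C(K, Y) (ContinuousMap.const K y))
    (hf : GenLoop.Homotopic (GenLoop.map (ContinuousMap.evalAt Y p) rfl f)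
      (GenLoop.const (x := y))) :
    ∃ g : Ω^ P Y y, GenLoop.Homotopic (hq.adjoint e g) f := by
  obtain ⟨H, h₀, h₁, hb⟩ := hf.exists_continuousMap
  have h₀ (t : I^N) : H (0, t) = f t p := h₀ t
  have h₁ (t : I^N) : H (1, t) = y := h₁ t
  have hscale {c : ℝ} {s : I^M} (h : 1 ≤ c * Cube.radius s) : q (Cube.scale c s) = p :=
    hq.apply_of_mem _ (Cube.scale_mem_boundary h)
  let F : C((I × (I^N)) × (I^M), Y) :=
    ⟨fun z ↦ if (1 + (z.1.1 : ℝ)) * Cube.radius z.2 ≤ 1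
      then f z.1.2 (q (Cube.scale (1 + z.1.1) z.2))
      else H (Set.projIcc 0 1 zero_le_one ((1 + (z.1.1 : ℝ)) * Cube.radius z.2 - 1), z.1.2), by
    refine Continuous.if_le (by fun_prop) ?_ (by fun_prop) continuous_const fun z hz ↦ ?_
    · exact H.continuous.comp (.prodMk (continuous_projIcc.comp (by fun_prop)) (by fun_prop))
    · rw [hscale hz.ge, hz, sub_self, Set.projIcc_left]
      exact (h₀ _).symm⟩
  have hF (z) : F z = if (1 + (z.1.1 : ℝ)) * Cube.radius z.2 ≤ 1
      then f z.1.2 (q (Cube.scale (1 + z.1.1) z.2))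
      else H (Set.projIcc 0 1 zero_le_one ((1 + (z.1.1 : ℝ)) * Cube.radius z.2 - 1), z.1.2) := rfl
  have hF₀ (t : I^N) (s : I^M) : F ((0, t), s) = f t (q s) := by
    rw [hF, if_pos (by simpa using Cube.radius_le_one s)]
    simp [Cube.scale_one]
  have hFs (τ : I) (t : I^N) (s : I^M) (hs : s ∈ Cube.boundary M) :
      F ((τ, t), s) = H (τ, t) := by
    rw [hF, Cube.radius_eq_one_of_mem_boundary hs]
    split_ifs with h
    · obtain rfl : τ = 0 := le_antisymm (Subtype.coe_le_coe.1 (by simpa using h)) τ.2.1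
      rw [h₀, hscale]
      simp [Cube.radius_eq_one_of_mem_boundary hs]
    · simp
  have hFt (τ : I) (t : I^N) (s : I^M) (ht : t ∈ Cube.boundary N) : F ((τ, t), s) = y := by
    rw [hF]
    split_ifs with h
    · exact DFunLike.congr_fun (f.2 t ht) _
    · exact hb _ _ ht
  refine ⟨⟨F.comp ⟨fun u ↦ ((1, fun i ↦ u (e (.inr i))), fun i ↦ u (e (.inl i))), by fun_prop⟩,
    fun u hu ↦ ?_⟩, ?_⟩
  · rcases Cube.mem_boundary_or e hu with hs | ht
    · exact (hFs _ _ _ hs).trans (h₁ _)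
    · exact hFt _ _ _ ht
  · refine (hq.homotopic_of_continuousMap F hF₀ (fun t s ↦ ?_)
      (fun τ t s hs s' hs' ↦ (hFs τ t s hs).trans (hFs τ t s' hs').symm)
      fun τ t ht s ↦ hFt τ t s ht).symm
    rw [adjoint_apply]
    change _ = F ((1, fun i ↦ Cube.join e s t (e (.inr i))), fun i ↦ Cube.join e s t (e (.inl i)))
    simp only [Cube.join_inl, Cube.join_inr]

theorem homotopic_const_of_adjoint [T2Space K] [CompactSpace K] [Fintype M] [Nonempty M]
    (hq : IsCubeModBoundary q p) (g : Ω^ P Y y)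
    (hg : GenLoop.Homotopic (hq.adjoint (N := N) e g) GenLoop.const) :
    GenLoop.Homotopic g GenLoop.const := by
  obtain ⟨H, h₀, h₁, hb⟩ := hg.exists_continuousMap
  have h₀ (t : I^N) (s : I^M) : H (0, t) (q s) = g (Cube.join e s t) := by
    rw [h₀, adjoint_apply]
  have h₁ (t : I^N) (z : K) : H (1, t) z = y := DFunLike.congr_fun (h₁ t) z
  have hb (τ : I) (t : I^N) (ht : t ∈ Cube.boundary N) (z : K) : H (τ, t) z = y :=
    DFunLike.congr_fun (hb τ t ht) z
  have hp (t : I^N) : H (0, t) p = y := by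
    have h : (0 : I^M) ∈ Cube.boundary M := ⟨Classical.arbitrary M, Or.inl rfl⟩
    rw [← hq.apply_of_mem 0 h, h₀]
    exact g.2 _ (Cube.join_mem_boundary_left e h t)
  let c : C(I^M, I) := ⟨fun s ↦ Set.projIcc 0 1 zero_le_one (2 - 2 * Cube.radius s),
    continuous_projIcc.comp (by fun_prop)⟩
  have hc {s : I^M} (hs : s ∈ Cube.boundary M) : c s = 0 :=
    Set.projIcc_of_le_left zero_le_one
      (by rw [Cube.radius_eq_one_of_mem_boundary hs]; norm_num)
  have hc' (s : I^M) : c s = 1 ∨ q (Cube.scale 2 s) = p := by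
    rcases le_total (2 * Cube.radius s) 1 with h | h
    · exact Or.inl (Set.projIcc_of_right_le zero_le_one (by linarith))
    · exact Or.inr (hq.apply_of_mem _ (Cube.scale_mem_boundary h))
  let E : C(I × (I^P), Y) := g.1.comp
    ⟨fun z ↦ Cube.join e (Cube.scale (1 + z.1) fun i ↦ z.2 (e (.inl i))) fun i ↦ z.2 (e (.inr i)),
      by fun_prop⟩
  have hE (τ : I) (u : I^P) (hu : u ∈ Cube.boundary P) : E (τ, u) = y := by
    refine g.2 _ ?_
    rcases Cube.mem_boundary_or e hu with hs | ht
    · refine Cube.join_mem_boundary_left e (Cube.scale_mem_boundary ?_) _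
      rw [Cube.radius_eq_one_of_mem_boundary hs]
      simpa using τ.2.1
    · exact Cube.join_mem_boundary_right e _ ht
  let L : C(I × (I^P), Y) := ⟨fun z ↦ H (unitInterval.symm z.1 * c fun i ↦ z.2 (e (.inl i)),
    fun i ↦ z.2 (e (.inr i))) p, by fun_prop⟩
  have hL (τ : I) (u : I^P) (hu : u ∈ Cube.boundary P) : L (τ, u) = y := by
    rcases Cube.mem_boundary_or e hu with hs | ht
    · refine Eq.trans ?_ (hp fun i ↦ u (e (.inr i)))
      simp [L, hc hs]
    · exact hb _ _ ht _
  let g₁ : Ω^ P Y y := ⟨E.comp (.prodMk (.const _ 1) (.id _)), hE 1⟩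
  let g₂ : Ω^ P Y y := ⟨L.comp (.prodMk (.const _ 0) (.id _)), hL 0⟩
  have hg₁ : GenLoop.Homotopic g g₁ := by
    refine GenLoop.homotopic_of_continuousMap E (fun u ↦ ?_) (fun u ↦ rfl) hE
    change g _ = _
    simp [Cube.scale_one, Cube.join_comp]
  have hg₂ : GenLoop.Homotopic g₂ GenLoop.const := by
    refine GenLoop.homotopic_of_continuousMap L (fun u ↦ rfl) (fun u ↦ ?_) hL
    refine Eq.trans ?_ (hp fun i ↦ u (e (.inr i)))
    simp [L]
  refine hg₁.trans (.trans ?_ hg₂)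
  refine GenLoop.homotopic_of_continuousMap
    ⟨fun z ↦ H (z.1 * c fun i ↦ z.2 (e (.inl i)), fun i ↦ z.2 (e (.inr i)))
      (q (Cube.scale 2 fun i ↦ z.2 (e (.inl i)))), by fun_prop⟩ (fun u ↦ ?_) (fun u ↦ ?_)
    fun τ u hu ↦ ?_
  · change H _ _ = g _
    norm_num [h₀]
  · change H (1 * c fun i ↦ u (e (.inl i)), _) _ =
      H (unitInterval.symm 0 * c fun i ↦ u (e (.inl i)), fun i ↦ u (e (.inr i))) p
    simp only [one_mul, unitInterval.symm_zero]
    rcases hc' fun i ↦ u (e (.inl i)) with h | h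
    · rw [h, h₁, h₁]
    · rw [h]
  · rcases Cube.mem_boundary_or e hu with hs | ht
    · change H _ _ = _
      dsimp only
      rw [hc hs, mul_zero, h₀]
      refine g.2 _ (Cube.join_mem_boundary_left e (Cube.scale_mem_boundary ?_) _)
      rw [Cube.radius_eq_one_of_mem_boundary hs]
      norm_num
    · exact hb _ _ ht _

/-- The splitting of the homotopy groups of the space of maps out of the quotient `K` of the cube
`I^M` by its boundary. -/
theorem nonempty_mulEquiv [T2Space K] [CompactSpace K] [Fintype M] [Nonempty M]
    (hq : IsCubeModBoundary q p) (e : M ⊕ N ≃ P) (y : Y) [DecidableEq N] [DecidableEq P] [Nontrivial N]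
    [Nonempty P] :
    Nonempty (HomotopyGroup N C(K, Y) (ContinuousMap.const K y) ≃*
      HomotopyGroup N Y y × HomotopyGroup P Y y) := by
  let ev : HomotopyGroup N C(K, Y) (ContinuousMap.const K y) →* HomotopyGroup N Y y :=
    HomotopyGroup.map (ContinuousMap.evalAt Y p) rfl
  let cst : HomotopyGroup N Y y →* HomotopyGroup N C(K, Y) (ContinuousMap.const K y) :=
    HomotopyGroup.map ContinuousMap.const' rfl
  let J : HomotopyGroup P Y y →* HomotopyGroup N C(K, Y) (ContinuousMap.const K y) :=
    hq.adjointHom e y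
  have ev_cst (a) : ev (cst a) = a := Quotient.inductionOn a fun f ↦ rfl
  have ev_J (b) : ev (J b) = 1 := Quotient.inductionOn b fun g ↦ by
    refine congrArg (Quotient.mk _) (GenLoop.ext _ _ fun t ↦ ?_)
    have h : (0 : I^M) ∈ Cube.boundary M := ⟨Classical.arbitrary M, Or.inl rfl⟩
    change hq.adjoint e g t p = y
    refine (congrArg (hq.adjoint e g t) (hq.apply_of_mem 0 h).symm).trans ?_
    rw [adjoint_apply]
    exact g.2 _ (Cube.join_mem_boundary_left e h t)
  have J_inj (b) : J b = 1 → b = 1 := Quotient.inductionOn b fun g hg ↦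
    Quotient.sound (hq.homotopic_const_of_adjoint e g (Quotient.exact hg))
  have J_surj (x) : ev x = 1 → ∃ b, J b = x := Quotient.inductionOn x fun f hf ↦
    (hq.exists_homotopic_adjoint e f (Quotient.exact hf)).imp' (Quotient.mk _)
      fun g hg ↦ Quotient.sound hg
  let Φ := cst.coprod J
  refine ⟨(MulEquiv.ofBijective Φ ⟨?_, fun x ↦ ?_⟩).symm⟩
  · refine (injective_iff_map_eq_one Φ).2 ?_
    rintro ⟨a, b⟩ h
    have h : cst a * J b = 1 := h
    have ha : a = 1 := by
      have := congrArg ev h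
      rwa [map_mul, ev_cst, ev_J, mul_one, map_one] at this
    rw [ha, map_one, one_mul] at h
    rw [ha, J_inj b h, Prod.mk_one_one]
  · obtain ⟨b, hb⟩ := J_surj ((cst (ev x))⁻¹ * x) (by rw [map_mul, map_inv, ev_cst, inv_mul_cancel])
    refine ⟨(ev x, b), ?_⟩
    change cst (ev x) * J b = x
    rw [hb, mul_inv_cancel_left]

end IsCubeModBoundary

section Sphere

variable {m : ℕ}

/-- The sum of the squares of the coordinates of a point of the cube `[-1, 1]^m`, where
`I^m` is identified with this cube. -/
noncomputable def Cube.sumSq (s : I^(Fin m)) : ℝ := ∑ i, (2 * (s i : ℝ) - 1) ^ 2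

theorem Cube.sumSq_nonneg (s : I^(Fin m)) : 0 ≤ Cube.sumSq s :=
  Finset.sum_nonneg fun _ _ ↦ sq_nonneg _

theorem Cube.sumSq_add_pos (s : I^(Fin m)) : 0 < Cube.sumSq s + (1 - Cube.radius s) ^ 2 := by
  have h₀ := Cube.sumSq_nonneg s
  rcases eq_or_ne (Cube.radius s) 1 with h | h
  · have hm : Nonempty (Fin m) := by
      by_contra hm
      rw [not_nonempty_iff] at hm
      have : Cube.radius s = 0 := by
        rw [Cube.radius, Subsingleton.elim (fun i ↦ 2 * (s i : ℝ) - 1) 0, norm_zero]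
      linarith
    obtain ⟨i, hi⟩ := Cube.exists_abs_eq_radius s
    have h₁ : (2 * (s i : ℝ) - 1) ^ 2 ≤ Cube.sumSq s :=
      Finset.single_le_sum (f := fun i ↦ (2 * (s i : ℝ) - 1) ^ 2) (fun _ _ ↦ sq_nonneg _)
        (Finset.mem_univ i)
    rw [← sq_abs, hi, h] at h₁
    nlinarith [sq_nonneg (1 - Cube.radius s)]
  · have : 0 < (1 - Cube.radius s) ^ 2 := by
      have := sub_ne_zero.2 h.symm
      positivity
    linarith

/-- The map from the cube to the sphere which collapses the boundary to the north pole. In the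
interior it is the radial homeomorphism onto `ℝ^m` followed by the inverse of the stereographic
projection. -/
noncomputable def cubeToSph (m : ℕ) : C(I^(Fin m), Sph m) where
  toFun s := ⟨WithLp.toLp 2 (Fin.snoc (α := fun _ ↦ ℝ)
    (fun i ↦ 2 * (1 - Cube.radius s) * (2 * (s i : ℝ) - 1) /
      (Cube.sumSq s + (1 - Cube.radius s) ^ 2))
    ((Cube.sumSq s - (1 - Cube.radius s) ^ 2) / (Cube.sumSq s + (1 - Cube.radius s) ^ 2))), by
    have h := Cube.sumSq_add_pos s
    rw [Sph, mem_sphere_zero_iff_norm, EuclideanSpace.norm_eq, Real.sqrt_eq_one,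
      Fin.sum_univ_castSucc]
    simp only [Fin.snoc_castSucc, Fin.snoc_last, Real.norm_eq_abs, sq_abs, div_pow, mul_pow]
    rw [← Finset.sum_div, ← Finset.mul_sum, ← Cube.sumSq]
    field_simp
    ring⟩
  continuous_toFun := by
    have h (s : I^(Fin m)) := (Cube.sumSq_add_pos s).ne'
    have hs : Continuous (Cube.sumSq (m := m)) := by unfold Cube.sumSq; fun_prop
    refine Continuous.subtype_mk ((PiLp.continuous_toLp 2 _).comp (continuous_pi fun i ↦ ?_)) _
    refine Fin.lastCases ?_ (fun i ↦ ?_) i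
    · simp only [Fin.snoc_last]
      fun_prop (disch := exact h _)
    · simp only [Fin.snoc_castSucc]
      fun_prop (disch := exact h _)

theorem cubeToSph_castSucc (s : I^(Fin m)) (i : Fin m) :
    (cubeToSph m s).1 i.castSucc = 2 * (1 - Cube.radius s) * (2 * (s i : ℝ) - 1) /
      (Cube.sumSq s + (1 - Cube.radius s) ^ 2) := by
  simp [cubeToSph]

theorem cubeToSph_last (s : I^(Fin m)) :
    (cubeToSph m s).1 (Fin.last m) = (Cube.sumSq s - (1 - Cube.radius s) ^ 2) /
      (Cube.sumSq s + (1 - Cube.radius s) ^ 2) := by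
  simp [cubeToSph]

theorem cubeToSph_last_eq_one_iff (s : I^(Fin m)) :
    (cubeToSph m s).1 (Fin.last m) = 1 ↔ Cube.radius s = 1 := by
  rw [cubeToSph_last, div_eq_one_iff_eq (Cube.sumSq_add_pos s).ne']
  constructor
  · intro h
    have : (1 - Cube.radius s) ^ 2 = 0 := by linarith
    linarith [pow_eq_zero_iff two_ne_zero |>.1 this]
  · intro h
    rw [h]; ring

theorem Sph.sum_sq (z : Sph m) :
    ∑ i : Fin m, z.1 i.castSucc ^ 2 + z.1 (Fin.last m) ^ 2 = 1 := by
  have h : z.1 ∈ Metric.sphere 0 1 := z.2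
  rw [mem_sphere_zero_iff_norm, EuclideanSpace.norm_eq, Real.sqrt_eq_one,
    Fin.sum_univ_castSucc] at h
  simpa only [Real.norm_eq_abs, sq_abs] using h

theorem Sph.ext_castSucc {z w : Sph m} (h : ∀ i : Fin m, z.1 i.castSucc = w.1 i.castSucc)
    (h' : z.1 (Fin.last m) = w.1 (Fin.last m)) : z = w := by
  refine Subtype.ext (PiLp.ext fun i ↦ ?_)
  exact Fin.lastCases h' h i

theorem Sph.eq_northPole {z : Sph m} (h : z.1 (Fin.last m) = 1) : z = northPole m := by
  have h₁ := Sph.sum_sq z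
  rw [h, one_pow, add_eq_right, Finset.sum_eq_zero_iff_of_nonneg fun _ _ ↦ sq_nonneg _] at h₁
  refine Sph.ext_castSucc (fun i ↦ ?_) ?_
  · rw [pow_eq_zero_iff two_ne_zero |>.1 (h₁ i (Finset.mem_univ i))]
    simp [northPole]
  · simp [northPole, h]

/-- The image of a point of the interior of the cube under stereographic projection. -/
theorem cubeToSph_stereographic (s : I^(Fin m)) (hs : Cube.radius s ≠ 1) (i : Fin m) :
    (cubeToSph m s).1 i.castSucc / (1 - (cubeToSph m s).1 (Fin.last m)) =
      (2 * (s i : ℝ) - 1) / (1 - Cube.radius s) := by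
  have h := (Cube.sumSq_add_pos s).ne'
  have h' := sub_ne_zero.2 hs.symm
  have h₁ : 1 - (Cube.sumSq s - (1 - Cube.radius s) ^ 2) /
      (Cube.sumSq s + (1 - Cube.radius s) ^ 2) =
      2 * (1 - Cube.radius s) ^ 2 / (Cube.sumSq s + (1 - Cube.radius s) ^ 2) := by
    field_simp
    ring
  rw [cubeToSph_castSucc, cubeToSph_last, h₁]
  field_simp

theorem Cube.eq_of_forall_div_eq {s s' : I^(Fin m)} (hs : Cube.radius s ≠ 1)
    (hs' : Cube.radius s' ≠ 1)
    (h : ∀ i, (2 * (s i : ℝ) - 1) / (1 - Cube.radius s) =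
      (2 * (s' i : ℝ) - 1) / (1 - Cube.radius s')) : s = s' := by
  have hd : 0 < 1 - Cube.radius s := sub_pos.2 ((Cube.radius_le_one s).lt_of_ne hs)
  have hd' : 0 < 1 - Cube.radius s' := sub_pos.2 ((Cube.radius_le_one s').lt_of_ne hs')
  have hr {s : I^(Fin m)} (hd : 0 < 1 - Cube.radius s) :
      ‖fun i ↦ (2 * (s i : ℝ) - 1) / (1 - Cube.radius s)‖ =
        Cube.radius s / (1 - Cube.radius s) := by
    have : (fun i ↦ (2 * (s i : ℝ) - 1) / (1 - Cube.radius s)) =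
        (1 - Cube.radius s)⁻¹ • fun i ↦ 2 * (s i : ℝ) - 1 := by
      ext i
      simp [div_eq_inv_mul]
    rw [this, norm_smul, Real.norm_of_nonneg (inv_nonneg.2 hd.le), ← Cube.radius, div_eq_inv_mul]
  have hrr := hr hd
  rw [funext h, hr hd', div_eq_div_iff hd'.ne' hd.ne'] at hrr
  have hrr : Cube.radius s = Cube.radius s' := by linarith
  ext i
  have := h i
  rw [hrr, div_left_inj' hd'.ne'] at this
  linarith

theorem cubeToSph_surjective (hm : 1 ≤ m) : Function.Surjective (cubeToSph m) := by
  intro z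
  rcases eq_or_ne (z.1 (Fin.last m)) 1 with hz | hz
  · refine ⟨0, (Sph.eq_northPole ?_).trans (Sph.eq_northPole hz).symm⟩
    exact (cubeToSph_last_eq_one_iff _).2
      (Cube.radius_eq_one_of_mem_boundary ⟨⟨0, hm⟩, Or.inl rfl⟩)
  · set a := z.1 (Fin.last m) with ha
    have ha' : 1 - a ≠ 0 := sub_ne_zero.2 hz.symm
    let w : Fin m → ℝ := fun i ↦ z.1 i.castSucc / (1 - a)
    have hw : 0 < 1 + ‖w‖ := by positivity
    have hwi (i : Fin m) : |w i / (1 + ‖w‖)| ≤ 1 := by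
      rw [abs_div, abs_of_pos hw, div_le_one hw]
      have := norm_le_pi_norm w i
      rw [Real.norm_eq_abs] at this
      linarith
    let s : I^(Fin m) := fun i ↦ ⟨(w i / (1 + ‖w‖) + 1) / 2, by
      have := abs_le.1 (hwi i)
      constructor <;> linarith⟩
    have hs (i : Fin m) : 2 * (s i : ℝ) - 1 = w i / (1 + ‖w‖) := by
      simp only [s]; ring
    have hr : 1 - Cube.radius s = 1 / (1 + ‖w‖) := by
      have : (fun i ↦ 2 * (s i : ℝ) - 1) = (1 + ‖w‖)⁻¹ • w := by
        ext i
        rw [hs, Pi.smul_apply, smul_eq_mul, div_eq_inv_mul]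
      rw [Cube.radius, this, norm_smul, Real.norm_of_nonneg (inv_nonneg.2 hw.le)]
      field_simp
      ring
    have hsum : Cube.sumSq s = (1 - a ^ 2) / (1 - a) ^ 2 / (1 + ‖w‖) ^ 2 := by
      have hz := Sph.sum_sq z
      rw [← ha, ← eq_sub_iff_add_eq] at hz
      simp only [Cube.sumSq, hs, w, div_pow]
      rw [← Finset.sum_div, ← Finset.sum_div, hz]
    have hsum' : Cube.sumSq s + (1 - Cube.radius s) ^ 2 = 2 / (1 - a) / (1 + ‖w‖) ^ 2 := by
      rw [hsum, hr]
      field_simp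
      ring
    refine ⟨s, Sph.ext_castSucc (fun i ↦ ?_) ?_⟩
    · rw [cubeToSph_castSucc, hsum', hr, hs]
      simp only [w]
      field_simp
    · rw [cubeToSph_last, hsum', hsum, hr, ← ha]
      field_simp
      ring

theorem isCubeModBoundary_cubeToSph (hm : 1 ≤ m) :
    IsCubeModBoundary (cubeToSph m) (northPole m) where
  surjective := cubeToSph_surjective hm
  apply_of_mem s hs := Sph.eq_northPole
    ((cubeToSph_last_eq_one_iff s).2 (Cube.radius_eq_one_of_mem_boundary hs))
  eq_or_mem s s' h := by
    have : Nonempty (Fin m) := ⟨⟨0, hm⟩⟩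
    have hr : Cube.radius s = 1 ↔ Cube.radius s' = 1 := by
      rw [← cubeToSph_last_eq_one_iff, h, cubeToSph_last_eq_one_iff]
    by_cases hs : Cube.radius s = 1
    · exact Or.inr ⟨Cube.mem_boundary_of_radius_eq_one hs,
        Cube.mem_boundary_of_radius_eq_one (hr.1 hs)⟩
    · have hs' := mt hr.2 hs
      refine Or.inl (Cube.eq_of_forall_div_eq hs hs' fun i ↦ ?_)
      rw [← cubeToSph_stereographic s hs, ← cubeToSph_stereographic s' hs', h]

end Sphere

/-- For `m ≥ 1` and `k ≥ 2` (written as `k + 2`), there is a group isomorphism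
`π_k(C(S^m, Y), c_{y₀}) ≅ π_k(Y, y₀) × π_{m+k}(Y, y₀)`, where `c_{y₀}` is the constant map. -/
theorem stmt5 {Y : Type*} [TopologicalSpace Y] (y₀ : Y) (m : ℕ) (hm : 1 ≤ m) (k : ℕ) :
    Nonempty ((π_ (k + 2) C(Sph m, Y) (ContinuousMap.const (Sph m) y₀)) ≃*
      (π_ (k + 2) Y y₀) × (π_ (m + k + 2) Y y₀)) := by
  have : Nonempty (Fin m) := ⟨⟨0, hm⟩⟩
  have : CompactSpace (Sph m) := isCompact_iff_compactSpace.1 (isCompact_sphere _ _)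
  exact (isCubeModBoundary_cubeToSph hm).nonempty_mulEquiv (P := Fin (m + k + 2))
    (finSumFinEquiv (m := m) (n := k + 2)) y₀
end

section
/- Let Y be a topological space, m ≥ 1, and let N ∈ S^m be the north pole. The evaluation map ev_N : C(S^m, Y) → Y, ev_N(f) = f(N), has the homotopy lifting property with respect to all cubes: for every natural number q, every continuous map H : I^q × I → Y (where I = [0,1] and I^q is the q-fold product), and every continuous map h₀ : I^q → C(S^m, Y) satisfying (h₀(z))(N) = H(z,0) for all z ∈ I^q, there exists a continuous map H̃ : I^q × I → C(S^m, Y) with H̃(z,0) = h₀(z) and (H̃(z,t))(N) = H(z,t) for all z ∈ I^q and t ∈ I. In other words, ev_N is a Serre fibration. -/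
open Topology

section Contraction

variable {E : Type*} [NormedAddCommGroup E]

lemma max_shrink_factor_le_one {t : ℝ} (ht : 0 ≤ t) (v : E) :
    max 0 (1 - t / (2 * ‖v‖)) ≤ 1 := by
  have : 0 ≤ t / (2 * ‖v‖) := by positivity
  exact max_le zero_le_one (by linarith)

variable [NormedSpace ℝ E]

/-- The vector `v` shortened by `t / 2` (and `0` once its norm is at most `t / 2`). -/
noncomputable def shrink (t : ℝ) (v : E) : E :=
  (max 0 (1 - t / (2 * ‖v‖))) • v

lemma shrink_zero_left (v : E) : shrink 0 v = v := by
  simp [shrink]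

lemma shrink_eq_zero {t : ℝ} {v : E} (h : 2 * ‖v‖ ≤ t) : shrink t v = 0 := by
  rcases eq_or_ne v 0 with rfl | hv
  · simp [shrink]
  · have hpos : 0 < 2 * ‖v‖ := by positivity
    have : 1 ≤ t / (2 * ‖v‖) := (one_le_div hpos).2 h
    rw [shrink, max_eq_left (by linarith), zero_smul]

lemma norm_shrink_le {t : ℝ} (ht : 0 ≤ t) (v : E) : ‖shrink t v‖ ≤ ‖v‖ := by
  rw [shrink, norm_smul, Real.norm_of_nonneg (le_max_left _ _)]
  exact mul_le_of_le_one_left (norm_nonneg v) (max_shrink_factor_le_one ht v)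

lemma norm_sub_shrink_le {t : ℝ} (ht : 0 ≤ t) (v : E) : ‖v - shrink t v‖ ≤ t / 2 := by
  rcases eq_or_ne v 0 with rfl | hv
  · simp [shrink, div_nonneg ht]
  · have hpos : 0 < ‖v‖ := norm_pos_iff.2 hv
    have hfactor := max_shrink_factor_le_one ht v
    have hle := le_max_right 0 (1 - t / (2 * ‖v‖))
    have heq : v - shrink t v = (1 - max 0 (1 - t / (2 * ‖v‖))) • v := by
      rw [shrink, sub_smul, one_smul]
    rw [heq, norm_smul, Real.norm_of_nonneg (by linarith)]
    calc (1 - max 0 (1 - t / (2 * ‖v‖))) * ‖v‖ ≤ t / (2 * ‖v‖) * ‖v‖ := by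
          gcongr; linarith
      _ = t / 2 := by field_simp

lemma continuous_shrink : Continuous fun p : unitInterval × E => shrink (p.1 : ℝ) p.2 := by
  refine continuous_iff_continuousAt.2 fun ⟨t, v⟩ => ?_
  rcases eq_or_ne v 0 with rfl | hv
  · have hzero : shrink (t : ℝ) (0 : E) = 0 := by simp [shrink]
    rw [ContinuousAt, hzero]
    refine squeeze_zero_norm (fun p => norm_shrink_le p.1.2.1 p.2) ?_
    have hnorm : Continuous fun p : unitInterval × E => ‖p.2‖ := by fun_prop
    simpa using hnorm.tendsto (t, (0 : E))
  · have hne : 2 * ‖v‖ ≠ 0 := by simpa using hv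
    unfold shrink
    fun_prop (disch := exact hne)

/-- If `x` is a unit vector, shortening the vector from `n` to `x` by at most `1 / 2` does not
lead to the origin. -/
lemma add_shrink_sub_ne_zero (n : E) {x : E} (hx : ‖x‖ = 1) (t : unitInterval) :
    n + shrink (t : ℝ) (x - n) ≠ 0 := by
  intro h
  have hle := norm_sub_shrink_le t.2.1 (x - n)
  have heq : x - n - shrink (t : ℝ) (x - n) = x := by
    rw [sub_sub, h, sub_zero]
  rw [heq, hx] at hle
  linarith [t.2.2]

end Contraction

section Sphere

variable {m : ℕ}

instance : CompactSpace (Sph m) :=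
  isCompact_iff_compactSpace.1 (isCompact_sphere _ _)

lemma norm_coe_sph (x : Sph m) : ‖(x : EuclideanSpace ℝ (Fin (m + 1)))‖ = 1 :=
  mem_sphere_zero_iff_norm.1 x.2

/-- The sphere pulled towards `n`: at time `t`, all points within distance `t / 2` of `n` have
reached `n`. -/
noncomputable def pullTo (n : Sph m) (t : unitInterval) (x : Sph m) : Sph m :=
  ⟨NormedSpace.normalize (n.1 + shrink (t : ℝ) (x.1 - n.1)), mem_sphere_zero_iff_norm.2 <|
    NormedSpace.norm_normalize (add_shrink_sub_ne_zero n.1 (norm_coe_sph x) t)⟩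

lemma pullTo_zero (n x : Sph m) : pullTo n 0 x = x := by
  apply Subtype.ext
  simp [pullTo, shrink_zero_left, NormedSpace.normalize, norm_coe_sph]

lemma pullTo_eq {n x : Sph m} {t : unitInterval} (h : 2 * ‖x.1 - n.1‖ ≤ t) :
    pullTo n t x = n := by
  apply Subtype.ext
  simp [pullTo, shrink_eq_zero h, NormedSpace.normalize, norm_coe_sph]

lemma Continuous.pullTo {X : Type*} [TopologicalSpace X] (n : Sph m) {t : X → unitInterval}
    {x : X → Sph m} (ht : Continuous t) (hx : Continuous x) :
    Continuous fun a => pullTo n (t a) (x a) := by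
  have hmove : Continuous fun a => n.1 + shrink (t a : ℝ) ((x a).1 - n.1) :=
    continuous_const.add (continuous_shrink.comp
      (ht.prodMk ((continuous_subtype_val.comp hx).sub continuous_const)))
  refine Continuous.subtype_mk ?_ _
  unfold NormedSpace.normalize
  exact (hmove.norm.inv₀ fun a =>
    norm_ne_zero_iff.2 (add_shrink_sub_ne_zero n.1 (norm_coe_sph (x a)) (t a))).smul hmove

/-- Evaluation at a point of the sphere has the homotopy lifting property with respect to
every space. -/
theorem exists_homotopy_lift_eval {Y Z : Type*} [TopologicalSpace Y] [TopologicalSpace Z]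
    (n : Sph m) (H : Z × unitInterval → Y) (hH : Continuous H)
    (h₀ : Z → C(Sph m, Y)) (hh₀ : Continuous h₀) (hcompat : ∀ z, h₀ z n = H (z, 0)) :
    ∃ Ht : Z × unitInterval → C(Sph m, Y),
      Continuous Ht ∧ (∀ z, Ht (z, 0) = h₀ z) ∧ ∀ z t, Ht (z, t) n = H (z, t) := by
  let F : (Z × unitInterval) × Sph m → Y := fun p =>
    if (p.1.2 : ℝ) ≤ 2 * ‖p.2.1 - n.1‖ then h₀ p.1.1 (pullTo n p.1.2 p.2)
    else H (p.1.1, Set.projIcc 0 1 zero_le_one ((p.1.2 : ℝ) - 2 * ‖p.2.1 - n.1‖))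
  have hdist : Continuous fun p : (Z × unitInterval) × Sph m => 2 * ‖p.2.1 - n.1‖ := by
    fun_prop
  have htime : Continuous fun p : (Z × unitInterval) × Sph m => (p.1.2 : ℝ) := by fun_prop
  have hF : Continuous F := by
    refine Continuous.if_le ?_ ?_ htime hdist ?_
    · have hpull : Continuous fun p : (Z × unitInterval) × Sph m => pullTo n p.1.2 p.2 :=
        Continuous.pullTo n (by fun_prop) continuous_snd
      have hstart : Continuous fun p : (Z × unitInterval) × Sph m => h₀ p.1.1 :=
        hh₀.comp (continuous_fst.comp continuous_fst)
      exact hstart.eval hpull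
    · exact hH.comp ((continuous_fst.comp continuous_fst).prodMk
        (continuous_projIcc.comp (htime.sub hdist)))
    · intro p hp
      rw [pullTo_eq hp.ge, hcompat, hp, sub_self, Set.projIcc_left]
      rfl
  refine ⟨(ContinuousMap.mk F hF).curry, ContinuousMap.continuous _, fun z => ?_, fun z t => ?_⟩
  · ext x
    simp [F, pullTo_zero]
  · rcases eq_or_ne t 0 with rfl | ht
    · simp [F, pullTo_zero, hcompat]
    · have hpos : ¬ (t : ℝ) ≤ 0 := fun h => ht (Subtype.ext (le_antisymm h t.2.1))
      simp [F, hpos]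

end Sphere

/-- The evaluation map `ev_N : C(S^m, Y) → Y`, `f ↦ f N`, has the homotopy lifting
property with respect to all cubes `I^q`; i.e. it is a Serre fibration. -/
theorem stmt7 {Y : Type*} [TopologicalSpace Y] (m : ℕ) (hm : 1 ≤ m) (q : ℕ)
    (H : (Fin q → unitInterval) × unitInterval → Y) (hH : Continuous H)
    (h₀ : (Fin q → unitInterval) → C(Sph m, Y)) (hh₀ : Continuous h₀)
    (hcompat : ∀ z, (h₀ z) (northPole m) = H (z, 0)) :
    ∃ Ht : (Fin q → unitInterval) × unitInterval → C(Sph m, Y),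
      Continuous Ht ∧ (∀ z, Ht (z, 0) = h₀ z) ∧
        ∀ z t, (Ht (z, t)) (northPole m) = H (z, t) :=
  exists_homotopy_lift_eval (northPole m) H hH h₀ hh₀ hcompat
end

section
/- The space Γ₂⁺, i.e. the path component of the standard complex structure J₀ in the space of orthogonal complex structures on ℝ⁴, is homeomorphic to the unit sphere S² in ℝ³. -/
open Topology

/-- The space `Γ_n` of orthogonal complex structures on `ℝ^{2n}`: real `(2n) × (2n)` matrices
`J` (with `Fin (2n)` identified with `Fin n ⊕ Fin n`) such that `Jᵀ * J = 1` and `J * J = -1`,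
with the subspace topology. -/
def Gamma (n : ℕ) : Set (Matrix (Fin n ⊕ Fin n) (Fin n ⊕ Fin n) ℝ) :=
  {J | J.transpose * J = 1 ∧ J * J = -1}

/-- The standard complex structure `J₀` on `ℝ^{2n}`, given by the block matrix
`[[0, -1], [1, 0]]`. -/
def J0 (n : ℕ) : Matrix (Fin n ⊕ Fin n) (Fin n ⊕ Fin n) ℝ :=
  Matrix.fromBlocks 0 (-1) 1 0

theorem J0_mem (n : ℕ) : J0 n ∈ Gamma n := by
  constructor
  · simp [J0, Matrix.fromBlocks_transpose, Matrix.fromBlocks_multiply, ← Matrix.fromBlocks_one]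
  · have h : (-1 : Matrix (Fin n ⊕ Fin n) (Fin n ⊕ Fin n) ℝ)
        = Matrix.fromBlocks (-1) (-0) (-0) (-1) := by
      rw [← Matrix.fromBlocks_neg, Matrix.fromBlocks_one]
    simp [J0, Matrix.fromBlocks_multiply, h]

/-- `Γ_n⁺`: the path component of the standard complex structure `J₀` in `Γ_n`
(the homogeneous space `SO(2n)/U(n)`). -/
noncomputable def GammaPlus (n : ℕ) : Set (Gamma n) :=
  pathComponent (⟨J0 n, J0_mem n⟩ : Gamma n)

/-- `Γ_n⁺` pointed at `J₀`. -/
noncomputable def J0plus (n : ℕ) : GammaPlus n :=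
  ⟨⟨J0 n, J0_mem n⟩, mem_pathComponent_self _⟩

theorem transpose_eq_neg_of_mem_Gamma {n : ℕ} {J : Matrix (Fin n ⊕ Fin n) (Fin n ⊕ Fin n) ℝ}
    (hJ : J ∈ Gamma n) : J.transpose = -J := by
  have h : J.transpose * (J * J) = J := by rw [← mul_assoc, hJ.1, one_mul]
  rw [hJ.2, mul_neg, mul_one] at h
  rw [← h, neg_neg, h]

/-- The Pfaffian of a skew-symmetric `4 × 4` matrix. -/
def pfaffian (J : Matrix (Fin 2 ⊕ Fin 2) (Fin 2 ⊕ Fin 2) ℝ) : ℝ :=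
  J (.inl 0) (.inl 1) * J (.inr 0) (.inr 1) - J (.inl 0) (.inr 0) * J (.inl 1) (.inr 1)
    + J (.inl 0) (.inr 1) * J (.inl 1) (.inr 0)

theorem continuous_pfaffian : Continuous pfaffian := by
  unfold pfaffian
  fun_prop

/-- The orthogonal complex structure with first row `(0, x 0, x 1, x 2)` and Pfaffian `-1`. -/
def ofVector (x : EuclideanSpace ℝ (Fin 3)) : Matrix (Fin 2 ⊕ Fin 2) (Fin 2 ⊕ Fin 2) ℝ :=
  Matrix.fromBlocks !![0, x 0; -x 0, 0] !![x 1, x 2; -x 2, x 1]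
    !![-x 1, x 2; -x 2, -x 1] !![0, -x 0; x 0, 0]

/-- The first row of `J`, without its diagonal entry. -/
def toVector (J : Matrix (Fin 2 ⊕ Fin 2) (Fin 2 ⊕ Fin 2) ℝ) : EuclideanSpace ℝ (Fin 3) :=
  !₂[J (.inl 0) (.inl 1), J (.inl 0) (.inr 0), J (.inl 0) (.inr 1)]

theorem continuous_ofVector : Continuous ofVector := by
  refine continuous_matrix fun i j => ?_
  rcases i with i | i <;> rcases j with j | j <;> fin_cases i <;> fin_cases j <;>
    simp [ofVector] <;> fun_prop

theorem continuous_toVector : Continuous toVector := by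
  refine (PiLp.continuous_toLp 2 _).comp (continuous_pi fun i => ?_)
  fin_cases i <;> simp <;> fun_prop

theorem toVector_ofVector (x : EuclideanSpace ℝ (Fin 3)) : toVector (ofVector x) = x := by
  ext i
  fin_cases i <;> simp [toVector, ofVector]

theorem mem_Sph_two_iff (x : EuclideanSpace ℝ (Fin 3)) :
    x ∈ Sph 2 ↔ x 0 ^ 2 + x 1 ^ 2 + x 2 ^ 2 = 1 := by
  simp [Sph, EuclideanSpace.norm_eq, Fin.sum_univ_three]

theorem ofVector_mem_Gamma {x : EuclideanSpace ℝ (Fin 3)} (hx : x ∈ Sph 2) :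
    ofVector x ∈ Gamma 2 := by
  rw [mem_Sph_two_iff] at hx
  constructor
  all_goals
    ext i j
    rcases i with i | i <;> rcases j with j | j <;> fin_cases i <;> fin_cases j <;>
      simp [ofVector, Matrix.mul_apply] <;>
      first | ring1 | linear_combination hx | linear_combination -hx

theorem entry_swap {n : ℕ} {J : Matrix (Fin n ⊕ Fin n) (Fin n ⊕ Fin n) ℝ} (hJ : J ∈ Gamma n)
    (i j : Fin n ⊕ Fin n) : J i j = -J j i :=
  congrFun₂ (transpose_eq_neg_of_mem_Gamma hJ) j i

theorem diag_eq_zero {n : ℕ} {J : Matrix (Fin n ⊕ Fin n) (Fin n ⊕ Fin n) ℝ} (hJ : J ∈ Gamma n)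
    (i : Fin n ⊕ Fin n) : J i i = 0 := by
  linarith [entry_swap hJ i i]

theorem sum_row_sq {n : ℕ} {J : Matrix (Fin n ⊕ Fin n) (Fin n ⊕ Fin n) ℝ} (hJ : J ∈ Gamma n)
    (i : Fin n ⊕ Fin n) : ∑ j, J i j ^ 2 = 1 := by
  have h := congrFun₂ hJ.2 i i
  rw [Matrix.mul_apply, Matrix.neg_apply, Matrix.one_apply_eq] at h
  rw [← neg_eq_iff_eq_neg.2 h, ← Finset.sum_neg_distrib]
  refine Finset.sum_congr rfl fun j _ => ?_
  rw [entry_swap hJ j i]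
  ring

theorem first_row_sq {J : Matrix (Fin 2 ⊕ Fin 2) (Fin 2 ⊕ Fin 2) ℝ} (hJ : J ∈ Gamma 2) :
    J (.inl 0) (.inl 1) ^ 2 + J (.inl 0) (.inr 0) ^ 2 + J (.inl 0) (.inr 1) ^ 2 = 1 := by
  have h := sum_row_sq hJ (.inl 0)
  simp [diag_eq_zero hJ] at h
  linarith

/-- Orthogonal complex structures on `ℝ⁴` equal their Hodge dual up to the sign given by the Pfaffian. -/
theorem hodge_of_mem_Gamma {J : Matrix (Fin 2 ⊕ Fin 2) (Fin 2 ⊕ Fin 2) ℝ} (hJ : J ∈ Gamma 2) :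
    J (.inr 0) (.inr 1) = pfaffian J * J (.inl 0) (.inl 1) ∧
      J (.inl 1) (.inr 1) = -pfaffian J * J (.inl 0) (.inr 0) ∧
      J (.inl 1) (.inr 0) = pfaffian J * J (.inl 0) (.inr 1) := by
  have hrow := first_row_sq hJ
  have hs := entry_swap hJ
  have h := fun i j => congrFun₂ hJ.2 i j
  have h01 := h (.inl 0) (.inl 1)
  have h02 := h (.inl 0) (.inr 0)
  have h03 := h (.inl 0) (.inr 1)
  simp [Matrix.mul_apply, diag_eq_zero hJ] at h01 h02 h03
  rw [hs (.inr 0) (.inl 1), hs (.inr 1) (.inl 1)] at h01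
  rw [hs (.inr 1) (.inr 0)] at h02
  unfold pfaffian
  refine ⟨?_, ?_, ?_⟩
  · linear_combination (-J (.inr 0) (.inr 1)) * hrow +
      J (.inl 0) (.inr 0) * h03 - J (.inl 0) (.inr 1) * h02
  · linear_combination (-J (.inl 1) (.inr 1)) * hrow +
      J (.inl 0) (.inl 1) * h03 - J (.inl 0) (.inr 1) * h01
  · linear_combination (-J (.inl 1) (.inr 0)) * hrow +
      J (.inl 0) (.inl 1) * h02 - J (.inl 0) (.inr 0) * h01

theorem pfaffian_sq {J : Matrix (Fin 2 ⊕ Fin 2) (Fin 2 ⊕ Fin 2) ℝ} (hJ : J ∈ Gamma 2) :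
    pfaffian J ^ 2 = 1 := by
  obtain ⟨h₁, h₂, h₃⟩ := hodge_of_mem_Gamma hJ
  have hs := entry_swap hJ
  have r₀ := first_row_sq hJ
  have r₁ := sum_row_sq hJ (.inl 1)
  have r₂ := sum_row_sq hJ (.inr 0)
  have r₃ := sum_row_sq hJ (.inr 1)
  simp [diag_eq_zero hJ] at r₁ r₂ r₃
  rw [hs (.inl 1) (.inl 0), h₂, h₃] at r₁
  rw [hs (.inr 0) (.inl 0), hs (.inr 0) (.inl 1), h₁, h₃] at r₂
  rw [hs (.inr 1) (.inl 0), hs (.inr 1) (.inl 1), hs (.inr 1) (.inr 0), h₁, h₂] at r₃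
  linear_combination (r₁ + r₂ + r₃ - (1 + 2 * pfaffian J ^ 2) * r₀) / 2

theorem toVector_mem_Sph {J : Matrix (Fin 2 ⊕ Fin 2) (Fin 2 ⊕ Fin 2) ℝ} (hJ : J ∈ Gamma 2) :
    toVector J ∈ Sph 2 := by
  rw [mem_Sph_two_iff]
  simpa [toVector] using first_row_sq hJ

theorem ofVector_toVector {J : Matrix (Fin 2 ⊕ Fin 2) (Fin 2 ⊕ Fin 2) ℝ} (hJ : J ∈ Gamma 2)
    (hpf : pfaffian J = -1) : ofVector (toVector J) = J := by
  have hs := entry_swap hJ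
  have hd := diag_eq_zero hJ
  obtain ⟨h₁, h₂, h₃⟩ := hodge_of_mem_Gamma hJ
  rw [hpf] at h₁ h₂ h₃
  ext i j
  rcases i with i | i <;> rcases j with j | j <;> fin_cases i <;> fin_cases j <;>
    simp [ofVector, toVector, hd] <;>
    linarith [hs (.inl 1) (.inl 0), hs (.inr 0) (.inl 0), hs (.inr 0) (.inl 1),
      hs (.inr 1) (.inl 0), hs (.inr 1) (.inl 1), hs (.inr 1) (.inr 0)]

theorem pfaffian_of_mem_GammaPlus {J : Gamma 2} (hJ : J ∈ GammaPlus 2) :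
    pfaffian J.1 = -1 := by
  have hconn : IsPreconnected (GammaPlus 2) :=
    isPathConnected_pathComponent.isConnected.isPreconnected
  refine hconn.eq_of_sq_eq (f := fun J => pfaffian J.1) (g := fun _ => -1)
    (continuous_pfaffian.comp continuous_subtype_val).continuousOn continuousOn_const
    (fun K _ => ?_) (fun _ => by norm_num) (mem_pathComponent_self _) ?_ hJ
  · simp [pfaffian_sq K.2]
  · simp [pfaffian, J0]

theorem ofVector_mem_GammaPlus {x : EuclideanSpace ℝ (Fin 3)} (hx : x ∈ Sph 2) :
    (⟨ofVector x, ofVector_mem_Gamma hx⟩ : Gamma 2) ∈ GammaPlus 2 := by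
  have hrank : 1 < Module.rank ℝ (EuclideanSpace ℝ (Fin 3)) := by
    rw [← Module.finrank_eq_rank]
    simp
  have hpc : IsPathConnected (Sph 2) := isPathConnected_sphere hrank 0 zero_le_one
  have : PathConnectedSpace (Sph 2) := isPathConnected_iff_pathConnectedSpace.1 hpc
  have hbase : ofVector !₂[0, -1, 0] = J0 2 := by
    ext i j
    rcases i with i | i <;> rcases j with j | j <;> fin_cases i <;> fin_cases j <;>
      simp [ofVector, J0]
  have hmem : !₂[(0 : ℝ), -1, 0] ∈ Sph 2 := by simp [mem_Sph_two_iff]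
  let F : Sph 2 → Gamma 2 := fun y => ⟨ofVector y.1, ofVector_mem_Gamma y.2⟩
  have hF : Continuous F := (continuous_ofVector.comp continuous_subtype_val).subtype_mk _
  have hjoin := (PathConnectedSpace.joined (⟨_, hmem⟩ : Sph 2) ⟨x, hx⟩).map hF
  have h0 : F ⟨_, hmem⟩ = ⟨J0 2, J0_mem 2⟩ := Subtype.ext hbase
  rwa [h0] at hjoin

/-- `Γ₂⁺`, the path component of the standard complex structure `J₀` in the space of
orthogonal complex structures on `ℝ⁴`, is homeomorphic to the unit sphere `S² ⊆ ℝ³`. -/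
theorem stmt10 : Nonempty (↥(GammaPlus 2) ≃ₜ ↥(Sph 2)) := by
  exact ⟨{
    toFun := fun J => ⟨toVector J.1.1, toVector_mem_Sph J.1.2⟩
    invFun := fun x => ⟨⟨ofVector x.1, ofVector_mem_Gamma x.2⟩, ofVector_mem_GammaPlus x.2⟩
    left_inv := fun J => Subtype.ext <| Subtype.ext <|
      ofVector_toVector J.1.2 (pfaffian_of_mem_GammaPlus J.2)
    right_inv := fun x => Subtype.ext (toVector_ofVector x.1)
    continuous_toFun := (continuous_toVector.comp
      (continuous_subtype_val.comp continuous_subtype_val)).subtype_mk _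
    continuous_invFun := ((continuous_ofVector.comp continuous_subtype_val).subtype_mk
      fun x => ofVector_mem_Gamma x.2).subtype_mk fun x => ofVector_mem_GammaPlus x.2 }⟩
end
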